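/- The random variables X^u_{3,3} and X^s_{3,3} do not have the same distribution: P(X^u_{3,3} = 8/9) = 1/10 while P(X^s_{3,3} = 8/9) = 5/14. -/

import Mathlib

/-- The `m × n` tract of land, 0-indexed: lot `(i, j)` with `i < m` (row, from the north/top)
and `j < n` (column, from the west). -/
def grid (m n : ℕ) : Finset (ℕ × ℕ) := Finset.range m ×ˢ Finset.range n

/-- A house at `p = (i, j)` is blocked (w.r.t. configuration `C`) if its west, east and south
neighbours `(i, j-1)`, `(i, j+1)`, `(i+1, j)` all exist and lie in `C`.  (For `C ⊆ grid m n`,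
membership in `C` already guarantees existence; only `j - 1` needs the guard `1 ≤ j`.) -/
def Blocked (C : Finset (ℕ × ℕ)) (p : ℕ × ℕ) : Prop :=
  1 ≤ p.2 ∧ (p.1, p.2 - 1) ∈ C ∧ (p.1, p.2 + 1) ∈ C ∧ (p.1 + 1, p.2) ∈ C

/-- A configuration on the `m × n` tract is permissible if it consists of lots of the tract
and no house in it is blocked. -/
def Permissible (m n : ℕ) (C : Finset (ℕ × ℕ)) : Prop :=
  C ⊆ grid m n ∧ ∀ p ∈ C, ¬ Blocked C p

/-- A configuration is maximal if it is permissible and adding a house on any empty lot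
yields an impermissible configuration. -/
def MaximalConfig (m n : ℕ) (C : Finset (ℕ × ℕ)) : Prop :=
  Permissible m n C ∧ ∀ p ∈ grid m n, p ∉ C → ¬ Permissible m n (insert p C)

open scoped Classical in
/-- The greedy sequential-building map: process the lots in the order given by the list `σ`,
adding a house whenever the resulting configuration stays permissible. -/
noncomputable def G (m n : ℕ) (σ : List (ℕ × ℕ)) : Finset (ℕ × ℕ) :=
  σ.foldl (fun C p => if Permissible m n (insert p C) then insert p C else C) ∅

instance decBlocked (C : Finset (ℕ × ℕ)) (p : ℕ × ℕ) : Decidable (Blocked C p) := by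
  unfold Blocked; infer_instance

instance decPermissible (m n : ℕ) (C : Finset (ℕ × ℕ)) : Decidable (Permissible m n C) := by
  unfold Permissible; infer_instance

instance decMaximalConfig (m n : ℕ) (C : Finset (ℕ × ℕ)) : Decidable (MaximalConfig m n C) := by
  unfold MaximalConfig; infer_instance

/-- North row plus centre: the lots around `(0, 1)`. -/
def blockA : Finset (ℕ × ℕ) := {(0, 0), (0, 1), (0, 2), (1, 1)}

/-- The centre and its west, east, south neighbours. -/
def blockB : Finset (ℕ × ℕ) := {(1, 0), (1, 1), (1, 2), (2, 1)}

theorem perm_iff (C : Finset (ℕ × ℕ)) (hC : C ⊆ grid 3 3) :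
    Permissible 3 3 C ↔ ¬ blockA ⊆ C ∧ ¬ blockB ⊆ C := by
  constructor
  · rintro ⟨_, h⟩
    constructor
    · intro hA
      refine h (0, 1) (hA (by decide)) ⟨le_refl _, hA (by decide), hA (by decide), hA (by decide)⟩
    · intro hB
      refine h (1, 1) (hB (by decide)) ⟨le_refl _, hB (by decide), hB (by decide), hB (by decide)⟩
  · rintro ⟨hA, hB⟩
    refine ⟨hC, ?_⟩
    rintro ⟨i, j⟩ hp ⟨h1, hw, he, hs⟩
    have he' := hC he
    have hs' := hC hs
    simp only [grid, Finset.mem_product, Finset.mem_range] at h1 he' hs'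
    have hj : j = 1 := by omega
    subst hj
    have hi : i = 0 ∨ i = 1 := by omega
    rcases hi with rfl | rfl
    · apply hA
      intro q hq
      simp only [blockA, Finset.mem_insert, Finset.mem_singleton] at hq
      rcases hq with rfl | rfl | rfl | rfl <;> assumption
    · apply hB
      intro q hq
      simp only [blockB, Finset.mem_insert, Finset.mem_singleton] at hq
      rcases hq with rfl | rfl | rfl | rfl <;> assumption

/-- The lots other than the centre. -/
def ring8 : Finset (ℕ × ℕ) := (grid 3 3).erase (1, 1)

theorem perm_of_sub (C : Finset (ℕ × ℕ)) (hC : C ⊆ ring8) : Permissible 3 3 C := by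
  have hx : ((1, 1) : ℕ × ℕ) ∉ C := fun h => by simpa [ring8] using hC h
  rw [perm_iff C (hC.trans (Finset.erase_subset _ _))]
  exact ⟨fun h => hx (h (by decide)), fun h => hx (h (by decide))⟩

theorem perm_ring : ∀ T ∈ ring8.powerset, Permissible 3 3 T :=
  fun T hT => perm_of_sub T (Finset.mem_powerset.1 hT)

/-- The explicit list of maximal configurations. -/
def maxList : Finset (Finset (ℕ × ℕ)) :=
  insert ring8 ((blockA.erase (1, 1) ×ˢ blockB.erase (1, 1)).image
    (fun q => grid 3 3 \ {q.1, q.2}))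

theorem max_of_mem : ∀ C ∈ maxList, MaximalConfig 3 3 C := by decide +kernel

theorem blockA_sub : blockA ⊆ grid 3 3 := by decide

theorem blockB_sub : blockB ⊆ grid 3 3 := by decide

theorem mem_of_max (C : Finset (ℕ × ℕ)) (h : MaximalConfig 3 3 C) : C ∈ maxList := by
  obtain ⟨hp, hm⟩ := h
  have hC := hp.1
  unfold maxList
  rw [Finset.mem_insert, Finset.mem_image]
  by_cases hx : ((1, 1) : ℕ × ℕ) ∈ C
  · right
    rw [perm_iff C hC] at hp
    obtain ⟨hA, hB⟩ := hp
    obtain ⟨a, ha, ha'⟩ := Finset.not_subset.1 hA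
    obtain ⟨b, hb, hb'⟩ := Finset.not_subset.1 hB
    refine ⟨(a, b), ?_, ?_⟩
    · rw [Finset.mem_product, Finset.mem_erase, Finset.mem_erase]
      exact ⟨⟨fun (e : a = (1, 1)) => ha' (e ▸ hx), ha⟩, ⟨fun (e : b = (1, 1)) => hb' (e ▸ hx), hb⟩⟩
    · ext p
      simp only [Finset.mem_sdiff, Finset.mem_insert, Finset.mem_singleton, not_or]
      constructor
      · rintro ⟨hg, hpa, hpb⟩
        by_contra hn
        apply hm p hg hn
        rw [perm_iff _ (Finset.insert_subset hg hC)]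
        constructor
        · intro hs
          rcases Finset.mem_insert.1 (hs ha) with e | e
          · exact hpa e.symm
          · exact ha' e
        · intro hs
          rcases Finset.mem_insert.1 (hs hb) with e | e
          · exact hpb e.symm
          · exact hb' e
      · intro hpC
        exact ⟨hC hpC, fun e => ha' (e ▸ hpC), fun e => hb' (e ▸ hpC)⟩
  · left
    have hs : C ⊆ ring8 := Finset.subset_erase.2 ⟨hC, hx⟩
    refine Finset.Subset.antisymm hs fun p hpr => ?_
    by_contra hn
    exact hm p (Finset.erase_subset _ _ hpr) hn (perm_of_sub _ (Finset.insert_subset hpr hs))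

theorem card_maxList : maxList.card = 10 := by decide +kernel

theorem card_maxList8 : (maxList.filter (fun C => C.card = 8)).card = 1 := by decide +kernel

theorem card_grid : (grid 3 3).card = 9 := by decide

theorem perm_centre (C : Finset (ℕ × ℕ)) (hC : C ∈ (grid 3 3).powerset)
    (hp : Permissible 3 3 C) (hx : (1, 1) ∈ C) : C.card ≠ 8 := by
  intro h8
  rw [Finset.mem_powerset] at hC
  rw [perm_iff C hC] at hp
  obtain ⟨a, ha, ha'⟩ := Finset.not_subset.1 hp.1
  obtain ⟨b, hb, hb'⟩ := Finset.not_subset.1 hp.2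
  have hc : (grid 3 3 \ C).card = 1 := by
    rw [Finset.card_sdiff_of_subset hC, card_grid, h8]
  have hab : a = b := Finset.card_le_one.1 hc.le a
    (Finset.mem_sdiff.2 ⟨blockA_sub ha, ha'⟩) b (Finset.mem_sdiff.2 ⟨blockB_sub hb, hb'⟩)
  subst hab
  have : a ∈ blockA ∩ blockB := Finset.mem_inter.2 ⟨ha, hb⟩
  have e : blockA ∩ blockB = {(1, 1)} := by decide
  rw [e, Finset.mem_singleton] at this
  exact ha' (this ▸ hx)

/-- The sets of lots that, once built, block the centre. -/
def good : Finset (Finset (ℕ × ℕ)) :=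
  ring8.powerset.filter (fun T => ¬ Permissible 3 3 (insert (1, 1) T))

theorem good_eq : good = ring8.powerset.filter
    (fun T => blockA.erase (1, 1) ⊆ T ∨ blockB.erase (1, 1) ⊆ T) := by
  unfold good
  refine Finset.filter_congr fun T hT => ?_
  rw [Finset.mem_powerset] at hT
  rw [perm_iff _ (Finset.insert_subset (by decide) (hT.trans (Finset.erase_subset _ _))),
    Finset.subset_insert_iff, Finset.subset_insert_iff]
  tauto

theorem sum_good : ∑ T ∈ good, T.card.factorial * (ring8 \ T).card.factorial = 129600 := by
  have h : ∀ T ∈ good, T.card.factorial * (ring8 \ T).card.factorial =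
      T.card.factorial * (8 - T.card).factorial := by
    intro T hT
    rw [Finset.card_sdiff_of_subset (Finset.mem_powerset.1 (Finset.mem_filter.1 hT).1)]
    rfl
  rw [Finset.sum_congr rfl h, good_eq]
  decide +kernel

/-- All orderings of a finite set. -/
noncomputable def orders (S : Finset (ℕ × ℕ)) : Finset (List (ℕ × ℕ)) :=
  S.toList.permutations.toFinset

theorem mem_orders (S : Finset (ℕ × ℕ)) (l : List (ℕ × ℕ)) :
    l ∈ orders S ↔ l.Nodup ∧ l.toFinset = S := by
  unfold orders
  rw [List.mem_toFinset, List.mem_permutations]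
  constructor
  · intro h
    exact ⟨h.nodup_iff.2 S.nodup_toList, by rw [List.toFinset_eq_of_perm _ _ h]; simp⟩
  · rintro ⟨h, rfl⟩
    exact (List.toFinset_toList h).symm

theorem card_orders (S : Finset (ℕ × ℕ)) : (orders S).card = S.card.factorial := by
  unfold orders
  rw [List.toFinset_card_of_nodup (List.nodup_permutations _ S.nodup_toList),
    List.length_permutations, Finset.length_toList]

/-- One step of the greedy map. -/
def step (C : Finset (ℕ × ℕ)) (p : ℕ × ℕ) : Finset (ℕ × ℕ) :=
  if Permissible 3 3 (insert p C) then insert p C else C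

theorem G_eq (σ : List (ℕ × ℕ)) : G 3 3 σ = σ.foldl step ∅ := by
  unfold G
  congr 1
  funext C p
  unfold step
  split_ifs <;> rfl

theorem fold_ring (l : List (ℕ × ℕ)) : ∀ C, C ⊆ ring8 → l.toFinset ⊆ ring8 →
    l.foldl step C = C ∪ l.toFinset := by
  induction l with
  | nil => intro C _ _; simp
  | cons p l ih =>
    intro C hC hl
    rw [List.toFinset_cons, Finset.insert_subset_iff] at hl
    have h1 : insert p C ⊆ ring8 := Finset.insert_subset hl.1 hC
    have h2 : step C p = insert p C := by
      unfold step
      rw [if_pos (perm_ring _ (Finset.mem_powerset.2 h1))]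
    rw [List.foldl_cons, h2, ih _ h1 hl.2]
    ext q; simp

theorem fold_centre (l : List (ℕ × ℕ)) : ∀ C, Permissible 3 3 C → (1, 1) ∈ C →
    Permissible 3 3 (l.foldl step C) ∧ (1, 1) ∈ l.foldl step C := by
  induction l with
  | nil => intro C h h'; exact ⟨h, h'⟩
  | cons p l ih =>
    intro C h h'
    rw [List.foldl_cons]
    unfold step
    split_ifs with hp
    · exact ih _ hp (Finset.mem_insert_of_mem h')
    · exact ih _ h h'

theorem G_card (l₁ l₂ : List (ℕ × ℕ)) (h₁ : l₁.toFinset ⊆ ring8) (h : l₂.toFinset = ring8 \ l₁.toFinset) :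
    (G 3 3 (l₁ ++ (1, 1) :: l₂)).card = 8 ↔ l₁.toFinset ∈ good := by
  have hg : l₁.toFinset ∈ good ↔ ¬ Permissible 3 3 (insert (1, 1) l₁.toFinset) := by
    simp [good, h₁]
  rw [hg, G_eq, List.foldl_append, List.foldl_cons, fold_ring _ _ (Finset.empty_subset _) h₁,
    Finset.empty_union]
  by_cases hp : Permissible 3 3 (insert (1, 1) l₁.toFinset)
  · have hs : step l₁.toFinset (1, 1) = insert (1, 1) l₁.toFinset := if_pos hp
    obtain ⟨ha, hb⟩ := fold_centre l₂ _ hp (Finset.mem_insert_self _ _)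
    rw [hs]
    simp only [hp, not_true_eq_false, iff_false]
    exact perm_centre _ (Finset.mem_powerset.2 ha.1) ha hb
  · have hs : step l₁.toFinset (1, 1) = l₁.toFinset := if_neg hp
    rw [hs, fold_ring _ _ h₁ (h ▸ Finset.sdiff_subset), h, Finset.union_sdiff_of_subset h₁]
    simp only [hp, not_false_eq_true, iff_true]
    decide +kernel

theorem grid_eq : grid 3 3 = insert (1, 1) ring8 := by decide +kernel

theorem centre_notMem : ((1, 1) : ℕ × ℕ) ∉ ring8 := by decide +kernel

/-- Triples: set of lots before the centre, and orders before and after. -/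
noncomputable def triples : Finset ((_ : Finset (ℕ × ℕ)) × (List (ℕ × ℕ) × List (ℕ × ℕ))) :=
  good.sigma (fun T => orders T ×ˢ orders (ring8 \ T))

theorem card_triples : triples.card = 129600 := by
  unfold triples
  rw [Finset.card_sigma, ← sum_good]
  refine Finset.sum_congr rfl fun T _ => ?_
  rw [Finset.card_product, card_orders, card_orders]

theorem mem_good_sub {T : Finset (ℕ × ℕ)} (h : T ∈ good) : T ⊆ ring8 :=
  Finset.mem_powerset.1 (Finset.mem_filter.1 h).1

theorem seq_eq : {σ : List (ℕ × ℕ) | σ.Nodup ∧ σ.toFinset = grid 3 3 ∧ (G 3 3 σ).card = 8} =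
    (triples.image (fun t => t.2.1 ++ (1, 1) :: t.2.2) : Finset (List (ℕ × ℕ))) := by
  ext σ
  simp only [Set.mem_ofPred_eq, Finset.coe_image, Set.mem_image, Finset.mem_coe]
  constructor
  · rintro ⟨hn, hs, hc⟩
    have hx : ((1, 1) : ℕ × ℕ) ∈ σ := by
      rw [← List.mem_toFinset, hs, grid_eq]; exact Finset.mem_insert_self _ _
    obtain ⟨l₁, l₂, rfl⟩ := List.append_of_mem hx
    rw [List.nodup_middle, List.nodup_cons, List.nodup_append] at hn
    obtain ⟨hx, hn₁, hn₂, hd⟩ := hn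
    have hm : ∀ q, q ∈ l₁ ∨ q ∈ l₂ ↔ q ∈ ring8 := by
      intro q
      have := congrArg (fun S => q ∈ S) hs
      simp only [grid_eq, List.toFinset_append, List.toFinset_cons, Finset.mem_union,
        Finset.mem_insert, List.mem_toFinset, eq_iff_iff] at this
      have hc := centre_notMem
      rw [List.mem_append] at hx
      by_cases hq : q = (1, 1)
      · subst hq; tauto
      · tauto
    have h₁ : l₁.toFinset ⊆ ring8 := fun q hq => (hm q).1 (Or.inl (List.mem_toFinset.1 hq))
    have h₂ : l₂.toFinset = ring8 \ l₁.toFinset := by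
      ext q
      rw [Finset.mem_sdiff, ← hm q, List.mem_toFinset, List.mem_toFinset]
      have : q ∈ l₁ → q ∈ l₂ → False := fun a b => hd q a q b rfl
      tauto
    refine ⟨⟨l₁.toFinset, l₁, l₂⟩, ?_, rfl⟩
    simp only [triples, Finset.mem_sigma, Finset.mem_product, mem_orders]
    exact ⟨(G_card _ _ h₁ h₂).1 hc, ⟨hn₁, trivial⟩, hn₂, h₂⟩
  · rintro ⟨⟨T, l₁, l₂⟩, ht, rfl⟩
    simp only [triples, Finset.mem_sigma, Finset.mem_product, mem_orders] at ht
    obtain ⟨hT, ⟨hn₁, rfl⟩, hn₂, h₂⟩ := ht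
    have h₁ := mem_good_sub hT
    have hm₂ : ∀ q, q ∈ l₂ ↔ q ∈ ring8 ∧ q ∉ l₁ := by
      intro q
      rw [← List.mem_toFinset, h₂, Finset.mem_sdiff, List.mem_toFinset]
    have hm₁ : ∀ q, q ∈ l₁ → q ∈ ring8 := fun q hq => h₁ (List.mem_toFinset.2 hq)
    refine ⟨?_, ?_, (G_card _ _ h₁ h₂).2 hT⟩
    · rw [List.nodup_middle, List.nodup_cons, List.nodup_append, List.mem_append]
      refine ⟨?_, hn₁, hn₂, ?_⟩
      · rintro (h | h)
        · exact centre_notMem (hm₁ _ h)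
        · exact centre_notMem ((hm₂ _).1 h).1
      · rintro a ha b hb rfl
        exact ((hm₂ _).1 hb).2 ha
    · ext q
      have := hm₁ q
      have := hm₂ q
      simp only [grid_eq, List.toFinset_append, List.toFinset_cons, Finset.mem_union,
        Finset.mem_insert, List.mem_toFinset]
      tauto

theorem inj_triples : Set.InjOn
    (fun t : (_ : Finset (ℕ × ℕ)) × (List (ℕ × ℕ) × List (ℕ × ℕ)) => t.2.1 ++ (1, 1) :: t.2.2)
    triples := by
  rintro ⟨T, l₁, l₂⟩ ht ⟨T', l₁', l₂'⟩ ht' h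
  simp only [triples, Finset.mem_coe, Finset.mem_sigma, Finset.mem_product, mem_orders] at ht ht'
  obtain ⟨hT, ⟨hn₁, rfl⟩, hn₂, h₂⟩ := ht
  obtain ⟨hT', ⟨hn₁', rfl⟩, hn₂', h₂'⟩ := ht'
  have a : ((1, 1) : ℕ × ℕ) ∉ l₁ := fun q => centre_notMem (mem_good_sub hT (List.mem_toFinset.2 q))
  have b : ((1, 1) : ℕ × ℕ) ∉ l₁' :=
    fun q => centre_notMem (mem_good_sub hT' (List.mem_toFinset.2 q))
  have c : ((1, 1) : ℕ × ℕ) ∉ l₂ := fun q => by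
    rw [← List.mem_toFinset, h₂] at q
    exact centre_notMem (Finset.sdiff_subset q)
  simp only at h
  have key : l₁ = l₁' ∧ l₂ = l₂' := by
    rw [List.append_eq_append_iff] at h
    rcases h with ⟨m, h1, h2⟩ | ⟨m, h1, h2⟩
    · cases m with
      | nil => simp_all
      | cons y m => simp_all
    · cases m with
      | nil => simp_all
      | cons y m => simp_all
  obtain ⟨rfl, rfl⟩ := key
  rfl

/-- The uniform model and the sequential model on the 3 × 3 tract give different
distributions of the building density: `P(Xᵘ = 8/9) = 1/10` but `P(Xˢ = 8/9) = 5/14`. -/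
theorem stmt_15 :
    ({C : Finset (ℕ × ℕ) | MaximalConfig 3 3 C ∧ C.card = 8}.ncard : ℚ) /
        ({C : Finset (ℕ × ℕ) | MaximalConfig 3 3 C}.ncard : ℚ) = 1 / 10 ∧
    ({σ : List (ℕ × ℕ) | σ.Nodup ∧ σ.toFinset = grid 3 3 ∧ (G 3 3 σ).card = 8}.ncard : ℚ) /
        (Nat.factorial 9 : ℚ) = 5 / 14 ∧
    (1 / 10 : ℚ) ≠ 5 / 14 := by
  have e1 : {C : Finset (ℕ × ℕ) | MaximalConfig 3 3 C ∧ C.card = 8} =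
      (maxList.filter (fun C => C.card = 8) : Finset (Finset (ℕ × ℕ))) := by
    ext C
    simp only [Set.mem_ofPred_eq, Finset.mem_coe, Finset.mem_filter]
    exact ⟨fun h => ⟨mem_of_max C h.1, h.2⟩, fun h => ⟨max_of_mem C h.1, h.2⟩⟩
  have e2 : {C : Finset (ℕ × ℕ) | MaximalConfig 3 3 C} = (maxList : Set (Finset (ℕ × ℕ))) := by
    ext C
    exact ⟨mem_of_max C, max_of_mem C⟩
  rw [e1, e2, seq_eq, Set.ncard_coe_finset, Set.ncard_coe_finset, Set.ncard_coe_finset,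
    card_maxList, card_maxList8, Finset.card_image_of_injOn inj_triples, card_triples]
  refine ⟨by norm_num, ?_, by norm_num⟩
  norm_num [Nat.factorial]
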